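/- arXiv:2108.04731 — 4 statements merged into one kernel-verified Lean document; each statement's English description precedes it below -/
import Mathlib

section
/- Let m ≥ 2 and 1 ≤ k ≤ m be integers, let p : {1,...,m} → [0,1] satisfy p₁ ≤ ... ≤ p_m, let F₁,...,F_k : [0,1] → X ⊆ ℝ satisfy Conditions (C1) and (C2) (each F_j weakly increasing, and F_j ≥ F_{j+1} pointwise), and let h : X^k → [0,1] be weakly increasing in every coordinate (Condition C3). For a size-k subset J = {j₁ < ... < j_k} of {1,...,m}, define Y^J := (F₁(p_{j₁}),...,F_k(p_{j_k})). Fix an index i ∈ {1,...,m} and define J* := {m−k+1,...,m} if i ≥ m−k+1, and J* := {i} ∪ {m−k+2,...,m} otherwise. Then for every size-k subset J of {1,...,m} with i ∈ J, it holds that h(Y^J) ≤ h(Y^{J*}). -/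
/-- A strictly monotone map `Fin k → Fin m` leaves room above each value for the values
of the larger arguments. -/
theorem StrictMono.fin_val_add_le {k m : ℕ} {f : Fin k → Fin m} (hf : StrictMono f)
    (a : Fin k) : (f a : ℕ) + k ≤ m + a := by
  have step : ∀ (d : ℕ) (hd : (a : ℕ) + d < k), (f a : ℕ) + d ≤ f ⟨a + d, hd⟩ := by
    intro d
    induction d with
    | zero => intro hd; exact le_rfl
    | succ d ih =>
      intro hd
      have hlt : f ⟨a + d, by omega⟩ < f ⟨a + (d + 1), hd⟩ :=
        hf (Fin.mk_lt_mk.mpr (by omega))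
      have := ih (by omega)
      have := Fin.lt_def.mp hlt
      omega
  have := step (k - 1 - a) (by omega)
  have := (f ⟨a + (k - 1 - a), by omega⟩).isLt
  omega

/-- The key step in the paper's Theorem (main): under the shortcut Conditions (C1)-(C3),
among all intersection hypotheses of a fixed size k containing a given elementary index i,
the largest statistic is attained at the set J* consisting of i together with the indices
of the largest p-values.  Indices are 0-based: the 1-based set {m-k+1,...,m} corresponds to
0-based indices {m-k,...,m-1}, and the 1-based condition i ≥ m-k+1 is `m - k ≤ i`. -/
theorem shortcut_worst_case_set (m k : ℕ) (hm : 2 ≤ m) (hk1 : 1 ≤ k) (hk : k ≤ m)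
    (i : Fin m)
    (p : Fin m → ℝ) (hp_sorted : Monotone p) (hp_mem : ∀ j, p j ∈ Set.Icc (0 : ℝ) 1)
    (X : Set ℝ) (F : Fin k → ℝ → ℝ)
    (hF_mem : ∀ j : Fin k, ∀ x ∈ Set.Icc (0 : ℝ) 1, F j x ∈ X)
    (hC1 : ∀ j : Fin k, MonotoneOn (F j) (Set.Icc (0 : ℝ) 1))
    (hC2 : ∀ (j : Fin k) (hj : (j : ℕ) + 1 < k), ∀ x ∈ Set.Icc (0 : ℝ) 1,
      F ⟨(j : ℕ) + 1, hj⟩ x ≤ F j x)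
    (h : (Fin k → ℝ) → ℝ)
    (hC3 : ∀ v w : Fin k → ℝ, (∀ a, v a ∈ X) → (∀ a, w a ∈ X) → (∀ a, v a ≤ w a) →
      h v ≤ h w)
    (hh_mem : ∀ v : Fin k → ℝ, (∀ a, v a ∈ X) → h v ∈ Set.Icc (0 : ℝ) 1)
    (J : Finset (Fin m)) (hJcard : J.card = k) (hiJ : i ∈ J) :
    h (fun a => F a (p (J.orderEmbOfFin hJcard a)))
      ≤ h (fun a => F a (p
          (if (a : ℕ) = 0 ∧ (i : ℕ) < m - k then i
           else ⟨m - k + (a : ℕ), by omega⟩))) := by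
  refine hC3 _ _ (fun a => hF_mem a _ (hp_mem _)) (fun a => hF_mem a _ (hp_mem _)) fun a => ?_
  refine hC1 a (hp_mem _) (hp_mem _) (hp_sorted ?_)
  split_ifs with ha
  · obtain ⟨b, hb⟩ : i ∈ Set.range (J.orderEmbOfFin hJcard) := by
      rwa [Finset.range_orderEmbOfFin]
    rw [← hb]
    exact (J.orderEmbOfFin hJcard).monotone (Fin.le_def.mpr (by omega))
  · have := (J.orderEmbOfFin hJcard).strictMono.fin_val_add_le a
    exact Fin.le_def.mpr (by dsimp only; omega)
end

section
/- Let (Ω, 𝓕, P) be a probability space, let I be a finite nonempty index set, let T ⊆ I be a nonempty subset (the indices of the true hypotheses), and let α ∈ [0,1]. For every nonempty subset J ⊆ I let φ^J : Ω → [0,1] be a measurable function, and assume that for every nonempty J ⊆ T it holds that P(φ^J ≤ α) ≤ α. Then P( there exists i ∈ T such that φ^K ≤ α for every K with {i} ⊆ K ⊆ I ) ≤ α. That is, the Closed Testing Procedure, which rejects the elementary hypothesis H_i at level α if and only if φ^K ≤ α for every superset K of {i} in I, controls the family-wise error rate at level α in the strong sense. -/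
open MeasureTheory

/-- Strong FWER control of the Closed Testing Procedure (Marcus, Peritz and Gabriel 1976;
Theorem 2 of the paper).  `I` indexes the elementary hypotheses, `T ⊆ I` the true ones,
and `φ J` is the local p-value for the intersection hypothesis indexed by `J`, assumed to
be a valid α-level test whenever `J ⊆ T` is nonempty.  The probability that some true
elementary hypothesis `i ∈ T` is rejected by the closed testing procedure (i.e. `φ K ≤ α`
for every `K` with `{i} ⊆ K ⊆ I`) is at most α. -/
theorem closed_testing_strong_fwer_control
    {Ω : Type*} [MeasurableSpace Ω] (P : Measure Ω) [IsProbabilityMeasure P]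
    {ι : Type*} (I T : Finset ι) (hI : I.Nonempty) (hTI : T ⊆ I) (hT : T.Nonempty)
    (α : ℝ) (hα : α ∈ Set.Icc (0 : ℝ) 1)
    (φ : Finset ι → Ω → ℝ) (hmeas : ∀ J, Measurable (φ J))
    (hrange : ∀ J ω, φ J ω ∈ Set.Icc (0 : ℝ) 1)
    (hlevel : ∀ J : Finset ι, J.Nonempty → J ⊆ T →
      P {ω | φ J ω ≤ α} ≤ ENNReal.ofReal α) :
    P {ω | ∃ i ∈ T, ∀ K : Finset ι, i ∈ K → K ⊆ I → φ K ω ≤ α} ≤ ENNReal.ofReal α := by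
  refine (measure_mono ?_).trans (hlevel T hT subset_rfl)
  rintro ω ⟨i, hiT, hi⟩
  exact hi T hiT hTI
end

section
/- Let (Ω, 𝓕, P) be a probability space, let I be a finite nonempty index set, let T ⊆ I (the indices of the true hypotheses), and let α ∈ [0,1]. For every nonempty subset J ⊆ I let φ^J : Ω → [0,1] be measurable, and assume that for every nonempty J ⊆ T it holds that P(φ^J ≤ α) ≤ α. Fix J ⊆ I, say a subset K ⊆ J is rejected by the Closed Testing Procedure if φ^L ≤ α for every L with K ⊆ L ⊆ I, and define the random variable t_α := max( {0} ∪ { |K| : K ⊆ J nonempty, K is not rejected } ). Then P( |T ∩ J| ≤ t_α ) ≥ 1 − α. That is, {0, 1, ..., t_α} is a 1−α confidence set for the number of true hypotheses in J, and {|J| − t_α, ..., |J|} is a 1−α confidence set for the number of false hypotheses in J. -/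
open MeasureTheory

/-- Theorem 5 of the paper (Goeman and Solari, 2011).  For a subset `J ⊆ I`, let
`t_α(ω)` be the largest cardinality of a nonempty subset `K ⊆ J` that is not rejected by
the Closed Testing Procedure (`K` is rejected iff `φ L ω ≤ α` for every `L` with
`K ⊆ L ⊆ I`), with `t_α(ω) = 0` if every such `K` is rejected.  Then
`{0, 1, ..., t_α}` is a `1 - α` confidence set for the number of true hypotheses in `J`:
`P(|T ∩ J| ≤ t_α) ≥ 1 - α`. -/
theorem goeman_solari_confidence_set
    {Ω : Type*} [MeasurableSpace Ω] (P : Measure Ω) [IsProbabilityMeasure P]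
    {ι : Type*} [DecidableEq ι] (I T J : Finset ι) (hI : I.Nonempty)
    (hTI : T ⊆ I) (hJI : J ⊆ I)
    (α : ℝ) (hα : α ∈ Set.Icc (0 : ℝ) 1)
    (φ : Finset ι → Ω → ℝ) (hmeas : ∀ K, Measurable (φ K))
    (hrange : ∀ K ω, φ K ω ∈ Set.Icc (0 : ℝ) 1)
    (hlevel : ∀ K : Finset ι, K.Nonempty → K ⊆ T →
      P {ω | φ K ω ≤ α} ≤ ENNReal.ofReal α) :
    1 - ENNReal.ofReal α ≤
      P {ω | (T ∩ J).card ≤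
        sSup ({0} ∪ {n : ℕ | ∃ K : Finset ι, K ⊆ J ∧ K.Nonempty ∧
          ¬(∀ L : Finset ι, K ⊆ L → L ⊆ I → φ L ω ≤ α) ∧ K.card = n})} := by
  obtain hTJ | hTJ := (T ∩ J).eq_empty_or_nonempty
  · simp [hTJ]
  · calc
      1 - ENNReal.ofReal α ≤ 1 - P {ω | φ T ω ≤ α} :=
        tsub_le_tsub_left (hlevel T (hTJ.mono Finset.inter_subset_left) subset_rfl) 1
      _ = P {ω | φ T ω ≤ α}ᶜ :=
        (prob_compl_eq_one_sub (measurableSet_le (hmeas T) measurable_const)).symm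
      _ ≤ _ := by
        refine measure_mono fun ω hω => le_csSup ⟨J.card, ?_⟩ (Or.inr ?_)
        · rintro n (rfl | ⟨K, hKJ, -, -, rfl⟩)
          · exact Nat.zero_le _
          · exact Finset.card_le_card hKJ
        · exact ⟨T ∩ J, Finset.inter_subset_right, hTJ,
            fun h => hω (h T Finset.inter_subset_left hTI), rfl⟩
end

section
/- Let m ≥ 2, let 1 ≤ c < m, and let 0 < x₁ < x₂ < ... < x_m < 1 be strictly increasing. Then the m-dimensional Lebesgue measure of the set E_c := { p ∈ [0,1]^m : for every i ∈ {1,...,c}, #{ j : p_j ≤ x_i } < i } is strictly greater than the m-dimensional Lebesgue measure of the set E_m := { p ∈ [0,1]^m : for every i ∈ {1,...,m}, #{ j : p_j ≤ x_i } < i }. Consequently, γ_{∞,c}(x) := 1 − vol(E_c) is strictly smaller than γ_{∞,m}(x) := 1 − vol(E_m). -/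
open MeasureTheory

/-- If `A` and a measurable set `B` of positive measure are disjoint subsets of a set of finite
measure, then `A` has strictly smaller measure than that set. -/
theorem measure_lt_of_disjoint_subset {α : Type*} [MeasurableSpace α] {μ : Measure α}
    {A B C : Set α} (hAC : A ⊆ C) (hBC : B ⊆ C) (hAB : Disjoint A B) (hB : MeasurableSet B)
    (hB0 : μ B ≠ 0) (hC : μ C ≠ ⊤) : μ A < μ C :=
  calc μ A < μ A + μ B := ENNReal.lt_add_right (measure_ne_top_of_subset hAC hC) hB0
    _ = μ (A ∪ B) := (measure_union hAB hB).symm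
    _ ≤ μ C := measure_mono (Set.union_subset hAC hBC)

/-- An open cube with nonempty side has positive volume. -/
theorem volume_pi_Ioo_ne_zero {ι : Type*} [Fintype ι] {a b : ℝ} (hab : a < b) :
    volume (Set.univ.pi fun _ : ι => Set.Ioo a b) ≠ 0 :=
  ((isOpen_set_pi Set.finite_univ fun _ _ => isOpen_Ioo).measure_pos volume
    (Set.univ_pi_nonempty_iff.2 fun _ => Set.nonempty_Ioo.2 hab)).ne'

/-- The measure-theoretic content of the paper's Lemma 1 (dominated): for strictly
increasing thresholds `0 < x₁ < ... < x_m < 1` and `1 ≤ c < m`, the event `E_c` that the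
first `c` order statistics exceed their thresholds has strictly larger Lebesgue measure
than the event `E_m` that all `m` order statistics do; consequently
`γ_{∞,c}(x) = 1 - vol(E_c) < 1 - vol(E_m) = γ_{∞,m}(x)`. -/
theorem truncated_cdf_strictly_dominated (m c : ℕ) (hm : 2 ≤ m) (hc1 : 1 ≤ c) (hc : c < m)
    (x : ℕ → ℝ) (hx0 : 0 < x 1) (hx1 : x m < 1)
    (hxmono : ∀ i j, 1 ≤ i → i < j → j ≤ m → x i < x j) :
    volume {p : Fin m → ℝ | (∀ j, p j ∈ Set.Icc (0 : ℝ) 1) ∧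
        ∀ i ∈ Finset.Icc 1 m, (Finset.univ.filter (fun j => p j ≤ x i)).card < i}
      < volume {p : Fin m → ℝ | (∀ j, p j ∈ Set.Icc (0 : ℝ) 1) ∧
          ∀ i ∈ Finset.Icc 1 c, (Finset.univ.filter (fun j => p j ≤ x i)).card < i} ∧
    1 - (volume {p : Fin m → ℝ | (∀ j, p j ∈ Set.Icc (0 : ℝ) 1) ∧
          ∀ i ∈ Finset.Icc 1 c, (Finset.univ.filter (fun j => p j ≤ x i)).card < i}).toReal
      < 1 - (volume {p : Fin m → ℝ | (∀ j, p j ∈ Set.Icc (0 : ℝ) 1) ∧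
          ∀ i ∈ Finset.Icc 1 m, (Finset.univ.filter (fun j => p j ≤ x i)).card < i}).toReal := by
  have hmono : ∀ i j, 1 ≤ i → i ≤ j → j ≤ m → x i ≤ x j := fun i j hi hij hj =>
    hij.eq_or_lt.elim (fun h => h ▸ le_rfl) fun h => (hxmono i j hi h hj).le
  have hfin : volume {p : Fin m → ℝ | (∀ j, p j ∈ Set.Icc (0 : ℝ) 1) ∧
      ∀ i ∈ Finset.Icc 1 c, (Finset.univ.filter (fun j => p j ≤ x i)).card < i} ≠ ⊤ := by
    refine measure_ne_top_of_subset (s := Set.Icc 0 1) ?_ isCompact_Icc.measure_ne_top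
    exact fun p hp => ⟨fun j => (hp.1 j).1, fun j => (hp.1 j).2⟩
  have hlt : volume {p : Fin m → ℝ | (∀ j, p j ∈ Set.Icc (0 : ℝ) 1) ∧
        ∀ i ∈ Finset.Icc 1 m, (Finset.univ.filter (fun j => p j ≤ x i)).card < i}
      < volume {p : Fin m → ℝ | (∀ j, p j ∈ Set.Icc (0 : ℝ) 1) ∧
        ∀ i ∈ Finset.Icc 1 c, (Finset.univ.filter (fun j => p j ≤ x i)).card < i} := by
    refine measure_lt_of_disjoint_subset
      (B := Set.univ.pi fun _ : Fin m => Set.Ioo (x c) (x (c + 1))) ?_ ?_ ?_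
      (MeasurableSet.univ_pi fun _ => measurableSet_Ioo)
      (volume_pi_Ioo_ne_zero (hxmono c (c + 1) hc1 c.lt_succ_self hc)) hfin
    · exact fun p hp => ⟨hp.1, fun i hi => hp.2 i (Finset.Icc_subset_Icc_right hc.le hi)⟩
    · intro p hp
      have hp' : ∀ j, x c < p j ∧ p j < x (c + 1) := fun j => hp j (Set.mem_univ j)
      refine ⟨fun j => ⟨?_, ?_⟩, fun i hi => ?_⟩
      · linarith [hp' j, hmono 1 c le_rfl hc1 hc.le]
      · linarith [hp' j, hmono (c + 1) m (by omega) hc le_rfl]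
      · obtain ⟨hi1, hic⟩ := Finset.mem_Icc.1 hi
        rw [Finset.filter_false_of_mem fun j _ =>
          not_le.2 ((hmono i c hi1 hic hc.le).trans_lt (hp' j).1)]
        exact hi1
    · refine Set.disjoint_left.2 fun p hp hpB => ?_
      have h := hp.2 m (Finset.mem_Icc.2 ⟨by omega, le_rfl⟩)
      rw [Finset.filter_true_of_mem fun j _ => (hpB j (Set.mem_univ j)).2.le.trans
        (hmono (c + 1) m (by omega) hc le_rfl), Finset.card_fin] at h
      exact h.false
  exact ⟨hlt, sub_lt_sub_left (ENNReal.toReal_strict_mono hfin hlt) 1⟩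
end
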